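/- arXiv:math/0106226 — 2 statements merged into one kernel-verified Lean document; each statement's English description precedes it below -/
import Mathlib

section
/- Let (R,m) be a Noetherian local commutative ring of prime characteristic p such that the annihilator ideal (0:m^p)_R = {x ∈ R | m^p ⊆ Ann(x)} is not contained in m^p. If M is a finitely generated R-module such that Tor^R_j(M, ^{φ^r}R) = 0 for some integers j, r ≥ 1, then M is projective. -/
open CategoryTheory

universe u

/-- `R` viewed as a module over itself by restriction of scalars along a ring
endomorphism `f : R →+* R` (here `f` will be the `r`-th Frobenius power `a ↦ a ^ p ^ r`),
i.e. the module `^{φ^r}R` with action `a · b = f a * b = a ^ p ^ r * b`. -/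
noncomputable abbrev frobMod {R : Type u} [CommRing R] (f : R →+* R) : ModuleCat.{u} R :=
  (ModuleCat.restrictScalars f).obj (ModuleCat.of R R)

open TensorProduct

section
variable {R : Type*} [CommRing R]

theorem lTensor_exists_of_comp_eq_zero {K F M A₀ A₁ A₂ A₃ : Type*}
    [AddCommGroup K] [Module R K] [AddCommGroup F] [Module R F] [AddCommGroup M] [Module R M]
    [AddCommGroup A₀] [Module R A₀] [AddCommGroup A₁] [Module R A₁]
    [AddCommGroup A₂] [Module R A₂] [AddCommGroup A₃] [Module R A₃]
    [Module.Flat R F] [Module.Flat R A₁]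
    {i : K →ₗ[R] F} {π : F →ₗ[R] M} (hi : Function.Injective i) (hiπ : Function.Exact i π)
    (hπ : Function.Surjective π)
    {d₃ : A₃ →ₗ[R] A₂} {d₂ : A₂ →ₗ[R] A₁} {d₁ : A₁ →ₗ[R] A₀}
    (h₂₁ : Function.Exact d₂ d₁) (h₃₂ : d₂ ∘ₗ d₃ = 0)
    (hM : Function.Exact (d₃.lTensor M) (d₂.lTensor M))
    (z : K ⊗[R] A₁) (hz : d₁.lTensor F (i.rTensor A₁ z) = 0) :
    ∃ u : K ⊗[R] A₂, d₂.lTensor K u = z := by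
  have hF := Module.Flat.lTensor_exact F h₂₁
  obtain ⟨w, hw⟩ := (hF _).1 hz
  have hw' : d₂.lTensor M (π.rTensor A₂ w) = 0 := by
    rw [← LinearMap.comp_apply, LinearMap.lTensor_comp_rTensor, ← LinearMap.rTensor_comp_lTensor,
      LinearMap.comp_apply, hw]
    exact (rTensor_exact A₁ hiπ hπ).apply_apply_eq_zero z
  obtain ⟨v', hv'⟩ := (hM _).1 hw'
  obtain ⟨v, rfl⟩ := LinearMap.rTensor_surjective A₃ hπ v'
  have hwv : π.rTensor A₂ (w - d₃.lTensor F v) = 0 := by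
    rw [map_sub, ← hv', sub_eq_zero, ← LinearMap.comp_apply, ← LinearMap.comp_apply,
      LinearMap.lTensor_comp_rTensor, LinearMap.rTensor_comp_lTensor]
  obtain ⟨u, hu⟩ := (rTensor_exact A₂ hiπ hπ _).1 hwv
  refine ⟨u, Module.Flat.rTensor_preserves_injective_linearMap i hi ?_⟩
  rw [← LinearMap.comp_apply, LinearMap.rTensor_comp_lTensor, ← LinearMap.lTensor_comp_rTensor,
    LinearMap.comp_apply, hu, map_sub, hw, ← LinearMap.comp_apply (d₂.lTensor F),
    ← LinearMap.lTensor_comp, h₃₂]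
  simp

theorem exists_ne_zero_mul_eq_zero_of_pow_smul {I : Ideal R} {x : R} (hx : x ≠ 0) (n : ℕ)
    (hn : ∀ a ∈ I ^ n, a * x = 0) : ∃ s : R, s ≠ 0 ∧ ∀ a ∈ I, a * s = 0 := by
  induction n with
  | zero => exact absurd (by simpa using hn 1 (by simp)) hx
  | succ n ih =>
    by_cases h : ∀ a ∈ I ^ n, a * x = 0
    · exact ih h
    · push Not at h
      obtain ⟨b, hb, hbx⟩ := h
      refine ⟨b * x, hbx, fun a ha => ?_⟩
      rw [← mul_assoc]
      exact hn _ (by rw [pow_succ']; exact Ideal.mul_mem_mul ha hb)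

theorem tmul_eq_zero_of_ker {K N : Type*} [AddCommGroup K] [Module R K] [AddCommGroup N]
    [Module R N] {n : ℕ} {i : K →ₗ[R] (Fin n → R)} (hi : Function.Injective (i.rTensor N))
    {I : Ideal R} (hK : ∀ k j, i k j ∈ I) {x : N} (hx : ∀ a ∈ I, a • x = 0) (k : K) :
    k ⊗ₜ[R] x = 0 := by
  apply hi
  rw [LinearMap.rTensor_tmul, map_zero, pi_eq_sum_univ (i k), TensorProduct.sum_tmul]
  refine Finset.sum_eq_zero fun j _ => ?_
  rw [TensorProduct.smul_tmul, hx _ (hK k j), TensorProduct.tmul_zero]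

theorem subsingleton_of_free_of_smul_eq_zero {K : Type*} [AddCommGroup K] [Module R K]
    [Module.Free R K] {s : R} (hs : s ≠ 0) (h : ∀ k : K, s • k = 0) : Subsingleton K := by
  by_contra hK
  have : Nontrivial K := not_subsingleton_iff_nontrivial.1 hK
  have b := Module.Free.chooseBasis R K
  obtain ⟨i⟩ := b.index_nonempty
  have := congrArg (fun y => b.repr y i) (h (b i))
  simp at this
  exact hs this

variable [IsLocalRing R]

open IsLocalRing

theorem exists_surjective_ker_le_maximalIdeal (M : Type*) [AddCommGroup M] [Module R M]
    [Module.Finite R M] :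
    ∃ (n : ℕ) (π : (Fin n → R) →ₗ[R] M), Function.Surjective π ∧
      ∀ k ∈ LinearMap.ker π, ∀ i, k i ∈ maximalIdeal R := by
  let b := Module.finBasis (ResidueField R) (ResidueField R ⊗[R] M)
  choose g hg using fun i => TensorProduct.mk_surjective R M (ResidueField R)
    Ideal.Quotient.mk_surjective (b i)
  refine ⟨_, Fintype.linearCombination R g, ?_, fun k hk i => ?_⟩
  · rw [← LinearMap.range_eq_top, Fintype.range_linearCombination]
    exact span_eq_top_of_tmul_eq_basis g b hg
  · have h : ∑ j, residue R (k j) • b j = 0 := by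
      have := congrArg (TensorProduct.mk R (ResidueField R) M 1) (LinearMap.mem_ker.1 hk)
      rw [Fintype.linearCombination_apply, map_sum, map_zero] at this
      rw [← this]
      refine Finset.sum_congr rfl fun j _ => ?_
      rw [map_smul, hg]
      exact algebraMap_smul (ResidueField R) (k j) (b j)
    exact (residue_eq_zero_iff _).1 (Fintype.linearIndependent_iff.1 b.linearIndependent _ h i)

theorem mem_maximalIdeal_smul_top_of_tmul_eq_zero {K N : Type*} [AddCommGroup K] [Module R K]
    [Module.Finite R K] [Nontrivial K] [AddCommGroup N] [Module R N] {x : N}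
    (hx : ∀ k : K, k ⊗ₜ[R] x = 0) : x ∈ maximalIdeal R • (⊤ : Submodule R N) := by
  obtain ⟨L, hL, -⟩ := (eq_top_or_exists_le_coatom (⊥ : Submodule R K)).resolve_left bot_ne_top
  have := isSimpleModule_iff_isCoatom.2 hL
  obtain ⟨I, hI, ⟨e⟩⟩ := isSimpleModule_iff_quot_maximal.1 this
  obtain rfl := eq_maximalIdeal hI
  obtain ⟨k, hk⟩ := (e.surjective.comp L.mkQ_surjective) 1
  have h := congrArg ((e.toLinearMap ∘ₗ L.mkQ).rTensor N) (hx k)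
  have hk' : (e.toLinearMap ∘ₗ L.mkQ) k = Ideal.Quotient.mk _ 1 := hk
  rw [LinearMap.rTensor_tmul, hk', map_zero] at h
  have h' := congrArg (quotTensorEquivQuotSMul N (maximalIdeal R)) h
  rw [map_zero, quotTensorEquivQuotSMul_mk_tmul, one_smul] at h'
  exact (Submodule.Quotient.mk_eq_zero _).1 h'


end

section

variable {R : Type u} [CommRing R]

theorem exact_lTensor_of_subsingleton_tor {N : ModuleCat.{u} R} (P : ProjectiveResolution N)
    (M : Type u) [AddCommGroup M] [Module R M] (n : ℕ)
    (h : Subsingleton (((Tor (ModuleCat.{u} R) (n + 1)).obj (ModuleCat.of R M)).obj N)) :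
    Function.Exact ((P.complex.d (n + 2) (n + 1)).hom.lTensor M)
      ((P.complex.d (n + 1) n).hom.lTensor M) := by
  have hz := ModuleCat.isZero_of_subsingleton
    (((Tor (ModuleCat.{u} R) (n + 1)).obj (ModuleCat.of R M)).obj N)
  have hz' := hz.of_iso (P.isoLeftDerivedObj
    ((MonoidalCategory.tensoringLeft _).obj (ModuleCat.of R M)) (n + 1)).symm
  have := (HomologicalComplex.exactAt_iff_isZero_homology _ _).2 hz'
  rw [HomologicalComplex.exactAt_iff' _ (n + 2) (n + 1) n (by simp) (by simp),
    ShortComplex.ShortExact.moduleCat_exact_iff_function_exact] at this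
  exact this
theorem CategoryTheory.ProjectiveResolution.function_exact_d {N : ModuleCat.{u} R} (P : ProjectiveResolution N) (n : ℕ) :
    Function.Exact (P.complex.d (n + 2) (n + 1)).hom (P.complex.d (n + 1) n).hom :=
  (ShortComplex.ShortExact.moduleCat_exact_iff_function_exact _).1 (P.exact_succ n)

theorem CategoryTheory.ProjectiveResolution.exists_augmentation {N : ModuleCat.{u} R}
    (P : ProjectiveResolution N) :
    ∃ ε : P.complex.X 0 →ₗ[R] N, Function.Surjective ε ∧
      Function.Exact (P.complex.d 1 0).hom ε :=
  ⟨(P.π.f 0).hom, (ModuleCat.epi_iff_surjective (P.π.f 0)).1 inferInstance,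
    (ShortComplex.ShortExact.moduleCat_exact_iff_function_exact _).1 P.exact₀⟩

open IsLocalRing in
theorem projective_of_exact_lTensor [IsNoetherianRing R] [IsLocalRing R]
    {s : R} (hs : s ≠ 0) (hms : ∀ a ∈ maximalIdeal R, a * s = 0)
    {N : ModuleCat.{u} R} (P : ProjectiveResolution N) {x : N}
    (hmx : ∀ a ∈ maximalIdeal R, a • x = 0)
    (hx : x ∉ maximalIdeal R • (⊤ : Submodule R N)) (n : ℕ)
    (M : Type u) [AddCommGroup M] [Module R M] [Module.Finite R M]
    (h : Function.Exact ((P.complex.d (n + 2) (n + 1)).hom.lTensor M)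
      ((P.complex.d (n + 1) n).hom.lTensor M)) :
    Module.Projective R M := by
  have hflat (k : ℕ) : Module.Flat R (P.complex.X k) := by
    have : Module.Projective R (P.complex.X k) :=
      (IsProjective.iff_projective _).2 (P.projective k)
    infer_instance
  have hcomp (k : ℕ) : (P.complex.d (k + 1) k).hom ∘ₗ (P.complex.d (k + 2) (k + 1)).hom = 0 := by
    rw [← ModuleCat.hom_comp, P.complex.d_comp_d, ModuleCat.hom_zero]
  induction n generalizing M with
  | zero =>
    obtain ⟨m, π, hπ, hker⟩ := exists_surjective_ker_le_maximalIdeal (R := R) M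
    have hi := (LinearMap.ker π).injective_subtype
    have hiπ := LinearMap.exact_subtype_ker_map π
    obtain ⟨ε, hε, hdε⟩ := P.exists_augmentation
    have hinj : Function.Injective ((LinearMap.ker π).subtype.rTensor N) := by
      rw [injective_iff_map_eq_zero]
      intro y hy
      obtain ⟨z, rfl⟩ := LinearMap.lTensor_surjective _ hε y
      obtain ⟨u, rfl⟩ := lTensor_exists_of_comp_eq_zero hi hiπ hπ hdε (hcomp 0) h z (by
        rw [← hy, ← LinearMap.comp_apply, ← LinearMap.comp_apply,
          LinearMap.lTensor_comp_rTensor, LinearMap.rTensor_comp_lTensor])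
      rw [← LinearMap.comp_apply, ← LinearMap.lTensor_comp, hdε.linearMap_comp_eq_zero,
        LinearMap.lTensor_zero, LinearMap.zero_apply]
    have hK : Subsingleton (LinearMap.ker π) := by
      by_contra hK
      have := not_subsingleton_iff_nontrivial.1 hK
      exact hx (mem_maximalIdeal_smul_top_of_tmul_eq_zero
        (tmul_eq_zero_of_ker hinj (fun k j => hker k k.2 j) hmx))
    exact Module.Projective.of_equiv (LinearEquiv.ofBijective π
      ⟨LinearMap.ker_eq_bot.1 (Submodule.subsingleton_iff_eq_bot.1 hK), hπ⟩)
  | succ n ih =>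
    obtain ⟨m, π, hπ, hker⟩ := exists_surjective_ker_le_maximalIdeal (R := R) M
    have hi := (LinearMap.ker π).injective_subtype
    have hiπ := LinearMap.exact_subtype_ker_map π
    have hproj : Module.Projective R (LinearMap.ker π) := by
      refine ih _ fun z => ⟨fun hz => ?_, ?_⟩
      · refine lTensor_exists_of_comp_eq_zero hi hiπ hπ (P.function_exact_d n) (hcomp (n + 1)) h z ?_
        rw [← LinearMap.comp_apply, LinearMap.lTensor_comp_rTensor,
          ← LinearMap.rTensor_comp_lTensor, LinearMap.comp_apply, hz, map_zero]
      · rintro ⟨w, rfl⟩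
        rw [← LinearMap.comp_apply, ← LinearMap.lTensor_comp, hcomp, LinearMap.lTensor_zero,
          LinearMap.zero_apply]
    have hfree : Module.Free R (LinearMap.ker π) := Module.free_of_flat_of_isLocalRing
    have hK : Subsingleton (LinearMap.ker π) := by
      refine subsingleton_of_free_of_smul_eq_zero hs fun k => Subtype.ext (funext fun j => ?_)
      simpa [mul_comm] using hms _ (hker k k.2 j)
    exact Module.Projective.of_equiv (LinearEquiv.ofBijective π
      ⟨LinearMap.ker_eq_bot.1 (Submodule.subsingleton_iff_eq_bot.1 hK), hπ⟩)

end

/-- Let `(R, m)` be a Noetherian local commutative ring of prime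
characteristic `p` such that `(0 : m^p)_R ⊄ m^p`.  If `M` is a finitely generated
`R`-module with `Tor^R_j(M, ^{φ^r}R) = 0` for some `j, r ≥ 1`, then `M` is projective. -/
theorem stmt0 {R : Type u} [CommRing R] [IsNoetherianRing R] [IsLocalRing R]
    (p : ℕ) (hp : p.Prime) [CharP R p]
    (hann : ¬ ((IsLocalRing.maximalIdeal R ^ p).annihilator ≤ IsLocalRing.maximalIdeal R ^ p))
    (M : Type u) [AddCommGroup M] [Module R M] [Module.Finite R M]
    (j r : ℕ) (hj : 1 ≤ j) (hr : 1 ≤ r)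
    (f : R →+* R) (hf : ∀ a, f a = a ^ p ^ r)
    (htor : Subsingleton
      (((Tor (ModuleCat.{u} R) j).obj (ModuleCat.of R M)).obj (frobMod f))) :
    Module.Projective R M := by
  obtain ⟨x, hx, hxm⟩ := SetLike.not_le_iff_exists.1 hann
  rw [Submodule.mem_annihilator] at hx
  have hx' : ∀ a ∈ IsLocalRing.maximalIdeal R ^ p, a * x = 0 := fun a ha => by
    rw [mul_comm]
    exact hx a ha
  have hf' : ∀ a ∈ IsLocalRing.maximalIdeal R, f a ∈ IsLocalRing.maximalIdeal R ^ p :=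
    fun a ha => by
      rw [hf]
      exact Ideal.pow_le_pow_right (Nat.le_self_pow (by lia) p) (Ideal.pow_mem_pow ha _)
  obtain ⟨s, hs, hms⟩ := exists_ne_zero_mul_eq_zero_of_pow_smul
    (x := x) (by rintro rfl; exact hxm (zero_mem _)) p hx'
  obtain ⟨n, rfl⟩ := Nat.exists_eq_add_of_le' hj
  let P := projectiveResolution (frobMod f)
  refine projective_of_exact_lTensor hs hms P (x := (x : R)) (fun a ha => hx' _ (hf' a ha))
    (fun hmem => hxm ?_) n M (exact_lTensor_of_subsingleton_tor P M n htor)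
  refine Submodule.smul_induction_on (p := fun y : frobMod f =>
    (show R from y) ∈ IsLocalRing.maximalIdeal R ^ p) hmem (fun a ha y _ => ?_)
    (fun y z hy hz => ?_)
  · exact Ideal.mul_mem_right (show R from y) _ (hf' a ha)
  · exact add_mem hy hz
end

section
/- Let (R,m) be a Noetherian local commutative ring of prime characteristic p with depth R = d > 0, let y = y_1, ..., y_d be a maximal R-regular sequence in m, and let c_y(R) be the smallest positive integer s such that, in the quotient ring R̄ = R/(y_1,...,y_d) with maximal ideal m̄, the socle (0:m̄)_{R̄} is not contained in m̄^s. Let M be a finitely generated R-module of infinite projective dimension. If Tor^R_j(M, ^{φ^r}R) = 0 for some integer j > 0 and some integer r with p^r > c_y(R), then there exists an integer n with j < n ≤ j + d such that Tor^R_n(M, ^{φ^r}R) ≠ 0. -/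
open CategoryTheory

universe u

/-- An `R`-module `M` has projective dimension `< j` if it admits a projective
resolution `P_•` with `P_n = 0` for all `n ≥ j`. -/
def HasProjDimLT (R : Type u) [CommRing R] (M : Type u) [AddCommGroup M] [Module R M]
    (j : ℕ) : Prop :=
  ∃ P : ProjectiveResolution (ModuleCat.of R M),
    ∀ n, j ≤ n → Limits.IsZero (P.complex.X n)

open TensorProduct RingTheory.Sequence

section Tor

variable {R : Type u} [CommRing R]

theorem tor_succ_subsingleton_iff (X : ModuleCat.{u} R) {Y : ModuleCat.{u} R}
    (P : ProjectiveResolution Y) (n : ℕ) :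
    Subsingleton (((Tor (ModuleCat.{u} R) (n + 1)).obj X).obj Y) ↔
      Function.Exact ((P.complex.d (n + 2) (n + 1)).hom.lTensor X)
        ((P.complex.d (n + 1) n).hom.lTensor X) := by
  let e := P.isoLeftDerivedObj ((MonoidalCategory.tensoringLeft (ModuleCat.{u} R)).obj X) (n + 1)
  rw [← ModuleCat.isZero_iff_subsingleton]
  refine (Iso.isZero_iff e).trans ?_
  refine (HomologicalComplex.exactAt_iff_isZero_homology _ _).symm.trans ?_
  rw [HomologicalComplex.exactAt_iff' _ (n + 2) (n + 1) n (by simp) (by simp),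
    ShortComplex.ShortExact.moduleCat_exact_iff_function_exact]
  rfl

theorem projectiveResolution_exact {Y : ModuleCat.{u} R} (P : ProjectiveResolution Y) (n : ℕ) :
    Function.Exact (P.complex.d (n + 2) (n + 1)).hom (P.complex.d (n + 1) n).hom :=
  (ShortComplex.ShortExact.moduleCat_exact_iff_function_exact _).mp (P.exact_succ n)

theorem projectiveResolution_exact_zero {Y : ModuleCat.{u} R} (P : ProjectiveResolution Y) :
    Function.Exact (P.complex.d 1 0).hom (P.π.f 0).hom ∧ Function.Surjective (P.π.f 0).hom :=
  ⟨(ShortComplex.ShortExact.moduleCat_exact_iff_function_exact _).mp P.exact₀,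
    (ModuleCat.epi_iff_surjective (P.π.f 0)).mp inferInstance⟩

instance projectiveResolution_flat {Y : ModuleCat.{u} R} (P : ProjectiveResolution Y) (n : ℕ) :
    Module.Flat R (P.complex.X n) :=
  have := IsProjective.iff_projective (R := R) (P.complex.X n) |>.mpr (P.projective n)
  inferInstance

theorem LinearMap.lTensor_rTensor_apply {A B C D : Type*} [AddCommGroup A] [Module R A]
    [AddCommGroup B] [Module R B] [AddCommGroup C] [Module R C] [AddCommGroup D] [Module R D]
    (f : A →ₗ[R] B) (g : C →ₗ[R] D) (x : A ⊗[R] C) :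
    g.lTensor B (f.rTensor C x) = f.rTensor D (g.lTensor A x) := by
  rw [← LinearMap.comp_apply, ← LinearMap.comp_apply, LinearMap.lTensor_comp_rTensor,
    LinearMap.rTensor_comp_lTensor]

/-- If the image of `a` in `G ⊗ P₀` is a boundary and `M ⊗ P` is exact one degree higher,
then `a` is already a boundary in `K ⊗ P`. -/
theorem exists_lTensor_eq_of_rTensor_eq {K G M P₀ P₁ P₂ : Type*} [AddCommGroup K] [Module R K]
    [AddCommGroup G] [Module R G] [AddCommGroup M] [Module R M] [AddCommGroup P₀] [Module R P₀]
    [AddCommGroup P₁] [Module R P₁] [AddCommGroup P₂] [Module R P₂] {i : K →ₗ[R] G} {π : G →ₗ[R] M} (hi : Function.Injective i)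
    (hiπ : Function.Exact i π) (hπ : Function.Surjective π)
    [Module.Flat R P₀] (d₁ : P₁ →ₗ[R] P₀) (d₂ : P₂ →ₗ[R] P₁)
    (hd : d₁ ∘ₗ d₂ = 0)
    (hM : Function.Exact (d₂.lTensor M) (d₁.lTensor M)) (a : K ⊗[R] P₀) (b : G ⊗[R] P₁)
    (hab : i.rTensor P₀ a = d₁.lTensor G b) : ∃ c, d₁.lTensor K c = a := by
  obtain ⟨δ, hδ⟩ := (hM (π.rTensor P₁ b)).mp (by
    rw [LinearMap.lTensor_rTensor_apply, ← hab]
    exact (rTensor_exact P₀ hiπ hπ).apply_apply_eq_zero a)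
  obtain ⟨δ', rfl⟩ := LinearMap.rTensor_surjective P₂ hπ δ
  rw [LinearMap.lTensor_rTensor_apply] at hδ
  obtain ⟨β, hβ⟩ := (rTensor_exact P₁ hiπ hπ (b - d₂.lTensor G δ')).mp (by
    rw [map_sub, hδ, sub_self])
  refine ⟨β, Module.Flat.rTensor_preserves_injective_linearMap i hi ?_⟩
  rw [← LinearMap.lTensor_rTensor_apply, hβ, map_sub, ← hab, ← LinearMap.comp_apply, ← LinearMap.lTensor_comp, hd]
  simp

variable {K G M : ModuleCat.{u} R} {i : K →ₗ[R] G} {π : G →ₗ[R] M}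
  (hi : Function.Injective i) (hiπ : Function.Exact i π) (hπ : Function.Surjective π)
  (Y : ModuleCat.{u} R)
include hi hiπ hπ

theorem tor_succ_subsingleton_of_exact [Module.Flat R G] (n : ℕ) (h : Subsingleton (((Tor (ModuleCat.{u} R) (n + 2)).obj M).obj Y)) :
    Subsingleton (((Tor (ModuleCat.{u} R) (n + 1)).obj K).obj Y) := by
  let P := projectiveResolution Y
  rw [tor_succ_subsingleton_iff _ P] at h ⊢
  have hd (n : ℕ) : (P.complex.d (n + 1) n).hom ∘ₗ (P.complex.d (n + 2) (n + 1)).hom = 0 :=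
    (projectiveResolution_exact P n).linearMap_comp_eq_zero
  intro a
  constructor
  · intro ha
    obtain ⟨b, hb⟩ := (Module.Flat.lTensor_exact G (projectiveResolution_exact P n) (i.rTensor _ a)).mp (by
      rw [← LinearMap.comp_apply, LinearMap.lTensor_comp_rTensor,
        ← LinearMap.rTensor_comp_lTensor, LinearMap.comp_apply, ha, map_zero])
    exact exists_lTensor_eq_of_rTensor_eq hi hiπ hπ _ _ (hd _) h a b hb.symm
  · rintro ⟨b, rfl⟩
    rw [← LinearMap.comp_apply, ← LinearMap.lTensor_comp, hd]
    simp

theorem rTensor_injective_of_tor_one_subsingleton (h : Subsingleton (((Tor (ModuleCat.{u} R) 1).obj M).obj Y)) :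
    Function.Injective (i.rTensor Y) := by
  let P := projectiveResolution Y
  rw [tor_succ_subsingleton_iff _ P] at h
  obtain ⟨hε, hε'⟩ := projectiveResolution_exact_zero P
  rw [injective_iff_map_eq_zero]
  intro a ha
  obtain ⟨a, rfl⟩ := LinearMap.lTensor_surjective K hε' a
  obtain ⟨b, hb⟩ := (lTensor_exact G hε hε' (i.rTensor _ a)).mp (by
    rwa [← LinearMap.comp_apply, LinearMap.lTensor_comp_rTensor,
        ← LinearMap.rTensor_comp_lTensor, LinearMap.comp_apply])
  obtain ⟨c, rfl⟩ := exists_lTensor_eq_of_rTensor_eq hi hiπ hπ _ _ (projectiveResolution_exact P 0).linearMap_comp_eq_zero h a b hb.symm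
  exact (lTensor_exact K hε hε').apply_apply_eq_zero c

end Tor

theorem IsWeaklyRegular.of_flat_module {S G : Type*} [CommRing S] [AddCommGroup G] [Module S G] [Module.Flat S G]
   {ys : List S} (h : IsWeaklyRegular S ys) : IsWeaklyRegular G ys :=
  ((TensorProduct.rid S G).isWeaklyRegular_congr ys).mp (h.isWeaklyRegular_lTensor (M₂ := G))

theorem mem_ofList_smul_top_of_injective {S K G M : Type*} [CommRing S] [AddCommGroup K] [Module S K]
    [AddCommGroup G] [Module S G] [AddCommGroup M] [Module S M]
    {i : K →ₗ[S] G} {π : G →ₗ[S] M} (hi : Function.Injective i)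
    (hiπ : Function.Exact i π) (hπ : Function.Surjective π) {ys : List S}
    (hM : IsWeaklyRegular M ys) {x : K} (hx : i x ∈ Ideal.ofList ys • (⊤ : Submodule S G)) :
    x ∈ Ideal.ofList ys • (⊤ : Submodule S K) := by
  have h0 : Function.Exact (0 : PUnit →ₗ[S] K) i := by
    rw [LinearMap.exact_iff, LinearMap.ker_eq_bot.mpr hi, LinearMap.range_zero]
  have := map_first_exact_on_four_term_right_exact_of_isSMulRegular_last h0 hiπ hπ hM
  obtain ⟨y, hy⟩ := (this (Submodule.Quotient.mk x)).mp (by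
    simpa [Submodule.Quotient.mk_eq_zero] using hx)
  obtain ⟨y, rfl⟩ := Submodule.Quotient.mk_surjective _ y
  rw [Submodule.mapQ_apply] at hy
  simpa [Submodule.Quotient.mk_eq_zero] using hy.symm

theorem IsWeaklyRegular.of_exact_append_singleton {S K G M : Type*} [CommRing S] [AddCommGroup K] [Module S K]
    [AddCommGroup G] [Module S G] [AddCommGroup M] [Module S M]
    {i : K →ₗ[S] G} {π : G →ₗ[S] M} (hi : Function.Injective i)
    (hiπ : Function.Exact i π) (hπ : Function.Surjective π) {ys : List S} {z : S}
    (hM : IsWeaklyRegular M ys) (hG : IsWeaklyRegular G (ys ++ [z])) : IsWeaklyRegular K (ys ++ [z]) := by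
  induction ys generalizing K G M with
  | nil =>
    simp only [List.nil_append, isWeaklyRegular_singleton_iff] at hG ⊢
    exact hG.of_injective i hi
  | cons y ys ih =>
    simp only [List.cons_append, isWeaklyRegular_cons_iff] at hM hG ⊢
    have h0 : Function.Exact (0 : PUnit →ₗ[S] K) i := by
      rw [LinearMap.exact_iff, LinearMap.ker_eq_bot.mpr hi, LinearMap.range_zero]
    have h1 := QuotSMulTop.map_first_exact_on_four_term_exact_of_isSMulRegular_last h0 hiπ hM.1
    refine ⟨hG.1.of_injective i hi, ih (i := QuotSMulTop.map y i) ?_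
      (QuotSMulTop.map_exact y hiπ hπ) (QuotSMulTop.map_surjective y hπ) hM.2 hG.2⟩
    rw [map_zero, LinearMap.exact_iff, LinearMap.range_zero] at h1
    exact LinearMap.ker_eq_bot.mp h1

theorem exists_minimal_cover {R M : Type*} [CommRing R] [IsLocalRing R] [AddCommGroup M] [Module R M] [Module.Finite R M] :
    ∃ (n : ℕ) (π : (Fin n → R) →ₗ[R] M), Function.Surjective π ∧
      LinearMap.ker π ≤ IsLocalRing.maximalIdeal R • (⊤ : Submodule R (Fin n → R)) := by
  let k := IsLocalRing.ResidueField R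
  let b := Module.finBasis k (k ⊗[R] M)
  choose g hg using fun i => TensorProduct.mk_surjective R M k Ideal.Quotient.mk_surjective (b i)
  refine ⟨_, Fintype.linearCombination R g, ?_, ?_⟩
  · rw [← LinearMap.range_eq_top, Fintype.range_linearCombination]
    exact IsLocalRing.span_eq_top_of_tmul_eq_basis g b hg
  · intro x hx
    have h1 : ∑ i, IsLocalRing.residue R (x i) • b i = 0 := by
      have := congrArg (TensorProduct.mk R k M 1) (LinearMap.mem_ker.mp hx)
      rw [Fintype.linearCombination_apply, map_sum, map_zero] at this
      rw [← this]
      refine Finset.sum_congr rfl fun i _ => ?_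
      rw [map_smul, hg]
      exact algebraMap_smul k (x i) (b i)
    have h2 := Fintype.linearIndependent_iff.mp b.linearIndependent _ h1
    rw [pi_eq_sum_univ x]
    refine Submodule.sum_mem _ fun i _ => Submodule.smul_mem_smul ?_ trivial
    exact (IsLocalRing.residue_eq_zero_iff _).mp (h2 i)

theorem subsingleton_of_socle_element {R S K G M : Type*} [CommRing R] [IsLocalRing R] [CommRing S] [Algebra R S]
    [AddCommGroup K] [Module R K] [AddCommGroup G] [Module R G] [AddCommGroup M] [Module R M]
    [Module.Finite R K]
    {i : K →ₗ[R] G} {π : G →ₗ[R] M} (hi : Function.Injective (i.baseChange S))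
    (hiπ : Function.Exact i π) (hπ : Function.Surjective π)
    (him : LinearMap.range i ≤ IsLocalRing.maximalIdeal R • ⊤) {ys : List S}
    (hM : IsWeaklyRegular (S ⊗[R] M) ys) {s : S}
    (hs : ∀ a ∈ IsLocalRing.maximalIdeal R, algebraMap R S a * s ∈ Ideal.ofList ys)
    (hs' : s ∉ Ideal.ofList ys ⊔ (IsLocalRing.maximalIdeal R).map (algebraMap R S)) :
    Subsingleton K := by
  by_contra hK
  rw [← IsLocalRing.subsingleton_tensorProduct (R := R), not_subsingleton_iff_nontrivial] at hK
  obtain ⟨v, hv⟩ := exists_ne (0 : IsLocalRing.ResidueField R ⊗[R] K)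
  obtain ⟨x, rfl⟩ := TensorProduct.mk_surjective R K _ Ideal.Quotient.mk_surjective v
  obtain ⟨φ, hφ⟩ := Module.Projective.exists_dual_ne_zero (IsLocalRing.ResidueField R) hv
  set J := Ideal.ofList ys ⊔ (IsLocalRing.maximalIdeal R).map (algebraMap R S)
  let q : IsLocalRing.ResidueField R →ₗ[R] S ⧸ J :=
    Submodule.liftQ (IsLocalRing.maximalIdeal R) (Algebra.linearMap R (S ⧸ J)) fun a ha => by
      rw [LinearMap.mem_ker, Algebra.linearMap_apply, IsScalarTower.algebraMap_apply R S (S ⧸ J)]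
      exact Ideal.Quotient.eq_zero_iff_mem.mpr (le_sup_right (a := Ideal.ofList ys)
        (Ideal.mem_map_of_mem _ ha))
  let φ' : IsLocalRing.ResidueField R ⊗[R] K →ₗ[IsLocalRing.ResidueField R] IsLocalRing.ResidueField R :=
    (φ (TensorProduct.mk R _ K 1 x))⁻¹ • φ
  let l : K →ₗ[R] S ⧸ J := q ∘ₗ φ'.restrictScalars R ∘ₗ TensorProduct.mk R _ K 1
  have hl : l x = 1 := by
    have : φ' (TensorProduct.mk R _ K 1 x) = 1 := inv_mul_cancel₀ hφ
    change q (φ' (TensorProduct.mk R _ K 1 x)) = 1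
    rw [this]
    exact map_one (algebraMap R (S ⧸ J))
  let Φ : S ⊗[R] K →ₗ[S] S ⧸ J := l.liftBaseChange S
  have hΦ : Φ (s ⊗ₜ x) = Ideal.Quotient.mk J s := by
    simp only [Φ, LinearMap.liftBaseChange_tmul, hl]
    rw [Algebra.smul_def, mul_one]
    rfl
  have hG : ∀ g ∈ IsLocalRing.maximalIdeal R • (⊤ : Submodule R G),
      s ⊗ₜ[R] g ∈ Ideal.ofList ys • (⊤ : Submodule S (S ⊗[R] G)) := by
    intro g hg
    induction hg using Submodule.smul_induction_on' with
    | smul a ha g _ =>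
      have : s ⊗ₜ[R] (a • g) = (algebraMap R S a * s) • ((1 : S) ⊗ₜ[R] g) := by
        rw [TensorProduct.smul_tmul', smul_eq_mul, mul_one, ← TensorProduct.smul_tmul,
          Algebra.smul_def]
      rw [this]
      exact Submodule.smul_mem_smul (hs a ha) trivial
    | add g _ g' _ h h' => rw [TensorProduct.tmul_add]; exact add_mem h h'
  have hmem := mem_ofList_smul_top_of_injective hi (π := π.baseChange S) (lTensor_exact S hiπ hπ)
    (LinearMap.lTensor_surjective S hπ) hM (x := s ⊗ₜ x) (hG _ (him ⟨x, rfl⟩))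
  have h0 : Φ (s ⊗ₜ x) ∈ Ideal.ofList ys • (⊤ : Submodule S (S ⧸ J)) :=
    Submodule.smul_top_le_comap_smul_top _ Φ hmem
  have h1 : Ideal.ofList ys • (⊤ : Submodule S (S ⧸ J)) = ⊥ := by
    rw [eq_bot_iff, Submodule.smul_le]
    rintro a ha b -
    obtain ⟨b, rfl⟩ := Ideal.Quotient.mk_surjective b
    exact Ideal.Quotient.eq_zero_iff_mem.mpr (Ideal.mul_mem_right _ _ (le_sup_left (a := Ideal.ofList ys) ha))
  rw [h1, hΦ, Submodule.mem_bot, Ideal.Quotient.eq_zero_iff_mem] at h0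
  exact hs' h0

/-- A sequence of modules `K n` in which each `K (n + 1)` is the kernel of a minimal free cover
of the finitely generated module `K n`. -/
structure MinimalSyzygies {R : Type u} [CommRing R] [IsLocalRing R] (K : ℕ → ModuleCat.{u} R) where
  rank : ℕ → ℕ
  incl (n : ℕ) : K (n + 1) →ₗ[R] (Fin (rank n) → R)
  cover (n : ℕ) : (Fin (rank n) → R) →ₗ[R] K n
  finite (n : ℕ) : Module.Finite R (K n)
  inj (n : ℕ) : Function.Injective (incl n)
  exact (n : ℕ) : Function.Exact (incl n) (cover n)
  surj (n : ℕ) : Function.Surjective (cover n)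
  minimal (n : ℕ) : LinearMap.range (incl n) ≤ IsLocalRing.maximalIdeal R • ⊤

theorem exists_minimalSyzygies {R : Type u} [CommRing R] [IsLocalRing R] [IsNoetherianRing R]
    (M : ModuleCat.{u} R) [Module.Finite R M] :
    ∃ K : ℕ → ModuleCat.{u} R, K 0 = M ∧ Nonempty (MinimalSyzygies K) := by
  choose n π hπ hker using fun X : {X : ModuleCat.{u} R // Module.Finite R X} =>
    have := X.2
    exists_minimal_cover (R := R) (M := X.1)
  let K : ℕ → {X : ModuleCat.{u} R // Module.Finite R X} := fun k =>
    Nat.rec ⟨M, inferInstance⟩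
      (fun _ X => ⟨ModuleCat.of R (LinearMap.ker (π X)),
        inferInstanceAs (Module.Finite R (LinearMap.ker (π X)))⟩) k
  exact ⟨fun k => (K k).1, rfl, ⟨{
    rank := fun k => n (K k)
    incl := fun k => (LinearMap.ker (π (K k))).subtype
    cover := fun k => π (K k)
    finite := fun k => (K k).2
    inj := fun k => Subtype.val_injective
    exact := fun k => LinearMap.exact_subtype_ker_map _
    surj := fun k => hπ _
    minimal := fun k => by rw [Submodule.range_subtype]; exact hker _ }⟩⟩

section
variable {R : Type u} [CommRing R] [IsLocalRing R] {K : ℕ → ModuleCat.{u} R} (C : MinimalSyzygies K)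

theorem MinimalSyzygies.d_comp_d (n : ℕ) :
    ModuleCat.ofHom (C.incl (n + 1) ∘ₗ C.cover (n + 2)) ≫ ModuleCat.ofHom (C.incl n ∘ₗ C.cover (n + 1)) = 0 := by
  ext1
  refine LinearMap.ext fun x => ?_
  change C.incl n (C.cover (n + 1) (C.incl (n + 1) (C.cover (n + 2) x))) = 0
  rw [(C.exact (n + 1)).apply_apply_eq_zero, map_zero]

noncomputable def MinimalSyzygies.complex : ChainComplex (ModuleCat.{u} R) ℕ :=
  ChainComplex.of (fun n => ModuleCat.of R (Fin (C.rank n) → R))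
    (fun n => ModuleCat.ofHom (C.incl n ∘ₗ C.cover (n + 1))) C.d_comp_d

theorem MinimalSyzygies.complex_d (n : ℕ) : C.complex.d (n + 1) n =
    ModuleCat.ofHom (C.incl n ∘ₗ C.cover (n + 1)) := ChainComplex.of_d
    (fun n => ModuleCat.of R (Fin (C.rank n) → R))
    (fun n => ModuleCat.ofHom (C.incl n ∘ₗ C.cover (n + 1))) n

theorem MinimalSyzygies.exactAt (n : ℕ) : C.complex.ExactAt (n + 1) := by
  rw [HomologicalComplex.exactAt_iff' _ (n + 2) (n + 1) n (by simp) (by simp),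
    ShortComplex.moduleCat_exact_iff]
  intro (x : Fin (C.rank (n + 1)) → R) hx
  replace hx : C.complex.d (n + 1) n x = 0 := hx
  rw [C.complex_d] at hx
  replace hx : C.incl n (C.cover (n + 1) x) = 0 := hx
  rw [map_eq_zero_iff _ (C.inj n)] at hx
  obtain ⟨y, rfl⟩ := (C.exact (n + 1) x).mp hx
  obtain ⟨z, rfl⟩ := C.surj (n + 2) y
  refine ⟨z, ?_⟩
  change C.complex.d (n + 2) (n + 1) z = _
  rw [C.complex_d]
  rfl

theorem MinimalSyzygies.d_comp_cover : C.complex.d 1 0 ≫ ModuleCat.ofHom (C.cover 0) = 0 := by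
  rw [C.complex_d]
  ext1
  refine LinearMap.ext fun x => ?_
  exact (C.exact 0).apply_apply_eq_zero _

noncomputable def MinimalSyzygies.projectiveResolution : ProjectiveResolution (K 0) where
  complex := C.complex
  projective n := (IsProjective.iff_projective (R := R) (Fin (C.rank n) → R)).mp inferInstance
  π := (ChainComplex.toSingle₀Equiv _ _).symm ⟨ModuleCat.ofHom (C.cover 0), C.d_comp_cover⟩
  quasiIso := ⟨fun n => by
    cases n
    · rw [ChainComplex.quasiIsoAt₀_iff, ShortComplex.quasiIso_iff_of_zeros']
      · have hex : (ShortComplex.mk _ _ C.d_comp_cover).Exact := by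
          rw [ShortComplex.moduleCat_exact_iff]
          intro x hx
          obtain ⟨y, rfl⟩ := (C.exact 0 x).mp hx
          obtain ⟨z, rfl⟩ := C.surj 1 y
          refine ⟨z, ?_⟩
          change C.complex.d 1 0 z = _
          rw [C.complex_d]
          rfl
        have hepi : Epi (ModuleCat.ofHom (C.cover 0)) :=
          (ModuleCat.epi_iff_surjective _).mpr (C.surj 0)
        have hf : ((ChainComplex.toSingle₀Equiv C.complex (K 0)).symm
            ⟨ModuleCat.ofHom (C.cover 0), C.d_comp_cover⟩).f 0 = ModuleCat.ofHom (C.cover 0) :=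
          ChainComplex.toSingle₀Equiv_symm_apply_f_zero _ _
        refine (ShortComplex.exact_and_epi_g_iff_of_iso ?_).2 ⟨hex, hepi⟩
        exact ShortComplex.isoMk (Iso.refl _) (Iso.refl _) (Iso.refl _)
          ((Category.id_comp _).trans (Category.comp_id _).symm)
          ((Category.id_comp _).trans
            (hf.symm.trans (Category.comp_id _).symm))
      all_goals rfl
    · rw [quasiIsoAt_iff_exactAt']
      · exact C.exactAt _
      · apply ChainComplex.exactAt_succ_single_obj⟩

theorem MinimalSyzygies.subsingleton_free {n : ℕ} (h : Subsingleton (K n)) :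
    Subsingleton (Fin (C.rank n) → R) := by
  have hr : LinearMap.range (C.incl n) = ⊤ := by
    rw [← (C.exact n).linearMap_ker_eq]
    exact eq_top_iff.mpr fun x _ => Subsingleton.elim _ _
  have hbot := Submodule.eq_bot_of_le_smul_of_le_jacobson_bot _ _ Module.Finite.fg_top
    (hr.ge.trans (C.minimal n)) (IsLocalRing.maximalIdeal_le_jacobson _)
  rw [← Submodule.subsingleton_iff R, ← subsingleton_iff_bot_eq_top]
  exact hbot.symm

include C in
theorem MinimalSyzygies.subsingleton_of_le {n m : ℕ} (hnm : n ≤ m) (h : Subsingleton (K n)) :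
    Subsingleton (K m) := by
  induction m, hnm using Nat.le_induction with
  | base => exact h
  | succ m _ ih =>
    have := C.subsingleton_free ih
    exact (C.inj m).subsingleton

include C in
theorem MinimalSyzygies.hasProjDimLT {n : ℕ} (h : Subsingleton (K n)) : HasProjDimLT R (K 0) n := by
  refine ⟨C.projectiveResolution, fun m hm => ?_⟩
  have := C.subsingleton_free (C.subsingleton_of_le hm h)
  exact ModuleCat.isZero_of_subsingleton (ModuleCat.of R (Fin (C.rank m) → R))

include C in
theorem MinimalSyzygies.tor_syzygy (Y : ModuleCat.{u} R) (k n : ℕ)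
    (h : Subsingleton (((Tor (ModuleCat.{u} R) (n + k + 1)).obj (K 0)).obj Y)) :
    Subsingleton (((Tor (ModuleCat.{u} R) (n + 1)).obj (K k)).obj Y) := by
  induction k generalizing n with
  | zero => exact h
  | succ k ih =>
    refine tor_succ_subsingleton_of_exact (G := ModuleCat.of R (Fin (C.rank k) → R))
      (C.inj k) (C.exact k) (C.surj k) Y n (ih (n + 1) ?_)
    rwa [add_right_comm n 1 k, add_assoc n k 1]

theorem MinimalSyzygies.baseChange_injective {S : Type u} [CommRing S] (f : R →+* S) (n : ℕ)
    (h : Subsingleton (((Tor (ModuleCat.{u} R) (n + 1)).obj (K 0)).obj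
      ((ModuleCat.restrictScalars f).obj (ModuleCat.of S S)))) :
    letI := f.toAlgebra
    Function.Injective ((C.incl n).baseChange S) := by
  let := f.toAlgebra
  have h1 := C.tor_syzygy _ n 0 (by rwa [zero_add])
  have h2 := rTensor_injective_of_tor_one_subsingleton
    (G := ModuleCat.of R (Fin (C.rank n) → R)) (C.inj n) (C.exact n) (C.surj n) _ h1
  exact (LinearMap.lTensor_inj_iff_rTensor_inj S (C.incl n)).mpr h2

theorem MinimalSyzygies.isWeaklyRegular_baseChange {S : Type*} [CommRing S] [Algebra R S] {ys : List S}
    (hys : IsWeaklyRegular S ys) {a : ℕ}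
    (h : ∀ n, a ≤ n → n < a + ys.length → Function.Injective ((C.incl n).baseChange S)) :
    IsWeaklyRegular (S ⊗[R] K (a + ys.length)) ys := by
  induction ys using List.reverseRecOn with
  | nil => simp
  | append_singleton ys z ih =>
    have hlen : (ys ++ [z]).length = ys.length + 1 := by simp
    rw [hlen] at h ⊢
    have hM := ih ((isWeaklyRegular_append_iff S ys [z]).mp hys).1
      fun n hn hn' => h n hn (by omega)
    exact IsWeaklyRegular.of_exact_append_singleton (h _ (by omega) (by omega)) (π := (C.cover (a + ys.length)).baseChange S)
      (lTensor_exact S (C.exact _) (C.surj _)) (LinearMap.lTensor_surjective S (C.surj _)) hM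
      (IsWeaklyRegular.of_flat_module hys)

include C in
theorem MinimalSyzygies.exists_tor_ne_zero {S : Type u} [CommRing S] (f : R →+* S) {ys : List S}
    (hys : IsWeaklyRegular S ys) {s : S}
    (hs : ∀ a ∈ IsLocalRing.maximalIdeal R, f a * s ∈ Ideal.ofList ys)
    (hs' : s ∉ Ideal.ofList ys ⊔ (IsLocalRing.maximalIdeal R).map f) {j : ℕ} (hj : 0 < j)
    (hpd : ¬ HasProjDimLT R (K 0) (j + ys.length)) :
    ∃ n, j ≤ n ∧ n ≤ j + ys.length ∧ ¬ Subsingleton (((Tor (ModuleCat.{u} R) n).obj (K 0)).obj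
      ((ModuleCat.restrictScalars f).obj (ModuleCat.of S S))) := by
  let := f.toAlgebra
  by_contra! h
  obtain ⟨a, rfl⟩ : ∃ a, j = a + 1 := ⟨j - 1, by omega⟩
  have hinj (n : ℕ) (hn : a ≤ n) (hn' : n ≤ a + ys.length) :
      Function.Injective ((C.incl n).baseChange S) :=
    C.baseChange_injective f n (h (n + 1) (by omega) (by omega))
  have hreg := C.isWeaklyRegular_baseChange hys fun n hn hn' => hinj n hn hn'.le
  have := C.finite (a + ys.length + 1)
  refine hpd (C.hasProjDimLT ?_)
  rw [add_right_comm]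
  exact subsingleton_of_socle_element (hinj _ (by omega) le_rfl) (C.exact _) (C.surj _) (C.minimal _) hreg hs hs'

end

/-- Let `(R, m)` be a Noetherian local commutative ring of prime
characteristic `p` with `depth R = d > 0`, let `y = y_1, …, y_d` be a maximal
`R`-regular sequence in `m` (it has length `d` and cannot be extended by any element
of `m`), and let `c = c_y(R)` be the smallest positive integer `s` such that, in
`R̄ = R/(y)` with maximal ideal `m̄ = m R̄`, the socle `(0 : m̄)_R̄` is not contained
in `m̄^s`.  Let `M` be a finitely generated `R`-module of infinite projective
dimension.  If `Tor^R_j(M, ^{φ^r}R) = 0` for some `j > 0` and some `r` with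
`p^r > c_y(R)`, then `Tor^R_n(M, ^{φ^r}R) ≠ 0` for some `n` with `j < n ≤ j + d`. -/
theorem stmt10 {R : Type u} [CommRing R] [IsNoetherianRing R] [IsLocalRing R]
    (p : ℕ) (hp : p.Prime) [CharP R p]
    (d : ℕ) (hd : 0 < d) (ys : List R) (hlen : ys.length = d)
    (hym : ∀ z ∈ ys, z ∈ IsLocalRing.maximalIdeal R)
    (hreg : RingTheory.Sequence.IsRegular R ys)
    (hmaximal : ∀ z ∈ IsLocalRing.maximalIdeal R,
      ¬ RingTheory.Sequence.IsRegular R (ys ++ [z]))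
    (c : ℕ) (hc0 : 0 < c)
    (hc : ¬ ((IsLocalRing.maximalIdeal R).map (Ideal.Quotient.mk (Ideal.ofList ys))).annihilator
      ≤ ((IsLocalRing.maximalIdeal R).map (Ideal.Quotient.mk (Ideal.ofList ys))) ^ c)
    (hcmin : ∀ s : ℕ, 0 < s → s < c →
      ((IsLocalRing.maximalIdeal R).map (Ideal.Quotient.mk (Ideal.ofList ys))).annihilator
        ≤ ((IsLocalRing.maximalIdeal R).map (Ideal.Quotient.mk (Ideal.ofList ys))) ^ s)
    (M : Type u) [AddCommGroup M] [Module R M] [Module.Finite R M]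
    (hpd : ¬ ∃ n : ℕ, HasProjDimLT R M n)
    (j r : ℕ) (hj : 0 < j) (hr : c < p ^ r)
    (f : R →+* R) (hf : ∀ a, f a = a ^ p ^ r)
    (htor : Subsingleton
      (((Tor (ModuleCat.{u} R) j).obj (ModuleCat.of R M)).obj (frobMod f))) :
    ∃ n : ℕ, j < n ∧ n ≤ j + d ∧
      ¬ Subsingleton (((Tor (ModuleCat.{u} R) n).obj (ModuleCat.of R M)).obj (frobMod f)) := by
  have hle : (IsLocalRing.maximalIdeal R).map f ≤ IsLocalRing.maximalIdeal R ^ c := by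
    rw [Ideal.map_le_iff_le_comap]
    intro a ha
    rw [Ideal.mem_comap, hf]
    exact Ideal.pow_le_pow_right hr.le (Ideal.pow_mem_pow ha _)
  obtain ⟨t, ht, htc⟩ := Set.not_subset.mp hc
  obtain ⟨s, rfl⟩ := Ideal.Quotient.mk_surjective t
  obtain ⟨K, hK, ⟨C⟩⟩ := exists_minimalSyzygies (ModuleCat.of R M)
  have hs : ∀ a ∈ IsLocalRing.maximalIdeal R, f a * s ∈ Ideal.ofList ys := by
    intro a ha
    have h := Submodule.mem_annihilator.mp ht _ (Ideal.mem_map_of_mem _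
      (show f a ∈ IsLocalRing.maximalIdeal R by
        rw [hf]; exact Ideal.pow_mem_of_mem _ ha _ (pow_pos hp.pos r)))
    rw [smul_eq_mul, mul_comm, ← map_mul] at h
    exact Ideal.Quotient.eq_zero_iff_mem.mp h
  have hs' : s ∉ Ideal.ofList ys ⊔ (IsLocalRing.maximalIdeal R).map f := by
    intro h
    refine htc ?_
    rw [SetLike.mem_coe, ← Ideal.map_pow]
    have h1 := Ideal.mem_map_of_mem (Ideal.Quotient.mk (Ideal.ofList ys)) (sup_le_sup_left hle _ h)
    rwa [Ideal.map_sup, Ideal.map_quotient_self, bot_sup_eq] at h1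
  obtain ⟨n, hjn, hn, hne⟩ := C.exists_tor_ne_zero f hreg.toIsWeaklyRegular hs hs' hj
    fun h => hpd ⟨_, hK ▸ h⟩
  rw [hK] at hne
  refine ⟨n, lt_of_le_of_ne hjn ?_, hlen ▸ hn, hne⟩
  rintro rfl
  exact hne htor
end
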